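/- The Koszul complex 0 → A^e ⊗ ∧^N(V) → ⋯ → A^e ⊗ ∧^2(V) → A^e ⊗ ∧^1(V) → A^e → A → 0, with differentials d_m and augmentation the multiplication map A^e → A, is exact; that is, it is a free resolution of A = S_q(V) as a left A^e-module. -/

import Mathlib

set_option synthInstance.maxHeartbeats 1000000
set_option maxHeartbeats 1000000

noncomputable section

open scoped TensorProduct

section QSA
variable (k : Type) [Field k] (N : ℕ) (q : Fin N → Fin N → k)

/-- The commutation relations of the quantum symmetric algebra. -/
inductive QRel : FreeAlgebra k (Fin N) → FreeAlgebra k (Fin N) → Prop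
  | rel (i j : Fin N) : QRel (FreeAlgebra.ι k i * FreeAlgebra.ι k j)
      (q i j • (FreeAlgebra.ι k j * FreeAlgebra.ι k i))

/-- The quantum symmetric algebra `A = S_q(V)`. -/
abbrev QSA := RingQuot (QRel k N q)

/-- The generator `x_i` of `S_q(V)`. -/
def X (i : Fin N) : QSA k N q := RingQuot.mkAlgHom k (QRel k N q) (FreeAlgebra.ι k i)

/-- The enveloping algebra `A^e = A ⊗_k A^{op}`. -/
abbrev QSAe := QSA k N q ⊗[k] (QSA k N q)ᵐᵒᵖ

/-- `A` is a left `A^e`-module via left and right multiplication. -/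
instance : Module (QSAe k N q) (QSA k N q) := TensorProduct.Algebra.module

/-- The `m`-th term `A^e ⊗ ∧^m(V)` of the Koszul complex, realised as the free
`A^e`-module on the set of `m`-element subsets of `{1,…,N}` (corresponding to the basis
`x_{j_1} ∧ ⋯ ∧ x_{j_m}`, `j_1 < ⋯ < j_m`, of `∧^m(V)`).  For `m > N` this module is zero. -/
abbrev KM (m : ℕ) := {S : Finset (Fin N) // S.card = m} →₀ QSAe k N q

/-- The Koszul differential `d_{m+1} : A^e ⊗ ∧^{m+1}(V) → A^e ⊗ ∧^m(V)`, determined by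
`d(1⊗1⊗ x_{j_1}∧⋯∧x_{j_{m+1}}) = Σ_i (-1)^{i+1} [(∏_{s≤i} q_{j_s,j_i}) x_{j_i}⊗1 -
(∏_{s≥i} q_{j_i,j_s}) 1⊗x_{j_i}] ⊗ x_{j_1}∧⋯∧x̂_{j_i}∧⋯∧x_{j_{m+1}}`. -/
def kd (m : ℕ) : KM k N q (m + 1) →ₗ[QSAe k N q] KM k N q m :=
  Finsupp.linearCombination (QSAe k N q)
    (fun S : {S : Finset (Fin N) // S.card = m + 1} =>
      ∑ i ∈ S.1.attach,
        ((-1 : k) ^ (S.1.filter (fun s => s < i.1)).card) •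
          Finsupp.single
            ⟨S.1.erase i.1, by rw [Finset.card_erase_of_mem i.2, S.2]; rfl⟩
            ((∏ s ∈ S.1.filter (fun s => s ≤ i.1), q s i.1) •
                (X k N q i.1 ⊗ₜ[k] (1 : (QSA k N q)ᵐᵒᵖ))
              - (∏ s ∈ S.1.filter (fun s => i.1 ≤ s), q i.1 s) •
                ((1 : QSA k N q) ⊗ₜ[k] MulOpposite.op (X k N q i.1))))

/-- The augmentation `A^e ⊗ ∧^0(V) = A^e → A`, given by multiplication. -/
def kaug : KM k N q 0 →ₗ[QSAe k N q] QSA k N q :=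
  Finsupp.linearCombination (QSAe k N q) (fun _ => (1 : QSA k N q))

end QSA


section AbstractKoszul
open Finset
variable {k : Type} [Field k] {B : Type} [Ring B] [Algebra k B] {N : ℕ}

def cf (q : Fin N → Fin N → k) (s i : Fin N) : k := if s < i then - q s i else 1
def cg (q : Fin N → Fin N → k) (s i : Fin N) : k := if s < i then -1 else q i s
def cc (q : Fin N → Fin N → k) (s i : Fin N) : k := if s < i then - q i s else 1

def zz (q : Fin N → Fin N → k) (x y : Fin N → B) (i : Fin N) (S : Finset (Fin N)) : B :=
  (∏ s ∈ S, cf q s i) • x i - (∏ s ∈ S, cg q s i) • y i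

def iot (q : Fin N → Fin N → k) (x y : Fin N → B) (i : Fin N) :
    (Finset (Fin N) →₀ B) →ₗ[k] (Finset (Fin N) →₀ B) :=
  Finsupp.lsum k (fun S => if i ∈ S then
    (Finsupp.lsingle (S.erase i)) ∘ₗ (LinearMap.mulRight k (zz q x y i S)) else 0)

def eps (q : Fin N → Fin N → k) (D : Fin N → B →ₗ[k] B) (i : Fin N) :
    (Finset (Fin N) →₀ B) →ₗ[k] (Finset (Fin N) →₀ B) :=
  Finsupp.lsum k (fun S => if i ∈ S then 0 else
    (Finsupp.lsingle (insert i S)) ∘ₗ ((∏ s ∈ S, cc q s i) • D i))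

lemma iot_mem (q : Fin N → Fin N → k) (x y : Fin N → B) {i : Fin N} {S} (h : i ∈ S) (u : B) :
    iot q x y i (Finsupp.single S u) = Finsupp.single (S.erase i) (u * zz q x y i S) := by
  simp [iot, h]
lemma iot_not_mem (q : Fin N → Fin N → k) (x y : Fin N → B) {i : Fin N} {S} (h : i ∉ S) (u : B) :
    iot q x y i (Finsupp.single S u) = 0 := by
  simp [iot, h]
lemma eps_mem (q : Fin N → Fin N → k) (D : Fin N → B →ₗ[k] B) {i : Fin N} {S} (h : i ∈ S) (u : B) :
    eps q D i (Finsupp.single S u) = 0 := by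
  simp [eps, h]
lemma eps_not_mem (q : Fin N → Fin N → k) (D : Fin N → B →ₗ[k] B) {i : Fin N} {S} (h : i ∉ S)
    (u : B) :
    eps q D i (Finsupp.single S u) =
      Finsupp.single (insert i S) ((∏ s ∈ S, cc q s i) • D i u) := by
  simp [eps, h]

structure KData (q : Fin N → Fin N → k) (x y : Fin N → B) (D : Fin N → B →ₗ[k] B)
    (V : ℕ → Submodule k B) : Prop where
  q0 : ∀ i j, q i j ≠ 0
  q1 : ∀ i, q i i = 1
  qinv : ∀ i j, q j i = (q i j)⁻¹
  xx : ∀ i j, x i * x j = q i j • (x j * x i)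
  yy : ∀ i j, y i * y j = q j i • (y j * y i)
  xy : ∀ i j, x i * y j = y j * x i
  Dx : ∀ i l, i ≠ l → ∀ u, D l (u * x i) = q l i • (D l u * x i)
  Dxx : ∀ i u, D i (u * x i) = D i u * x i + u
  Dy : ∀ i l u, D l (u * y i) = D l u * y i
  V0 : V 0 = ⊥
  Vtop : ∀ u, ∃ n, u ∈ V n
  Vmono : Monotone V
  VE : ∀ n, ∀ u ∈ V (n + 1), (n : k) • u - ∑ i, D i u * x i ∈ V n
  Vy : ∀ n, ∀ u ∈ V (n + 1), ∀ i, D i u * y i ∈ V n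

variable {q : Fin N → Fin N → k} {x y : Fin N → B} {D : Fin N → B →ₗ[k] B}
    {V : ℕ → Submodule k B}

lemma KData.fg (_H : KData q x y D V) {i j : Fin N} (h : i ≠ j) : cf q i j = - cg q j i := by
  unfold cf cg
  rcases lt_or_gt_of_ne h with h | h
  · simp [h, h.not_gt]
  · simp [h, h.not_gt]

lemma KData.fii (_H : KData q x y D V) (i : Fin N) : cf q i i = 1 := by simp [cf]
lemma KData.gii (H : KData q x y D V) (i : Fin N) : cg q i i = 1 := by simp [cg, H.q1]
lemma KData.qq (H : KData q x y D V) (i j : Fin N) : q i j * q j i = 1 := by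
  rw [H.qinv i j]; exact mul_inv_cancel₀ (H.q0 i j)
lemma KData.cfm (H : KData q x y D V) (i j : Fin N) : cc q i j * cf q i j = 1 := by
  unfold cc cf; split_ifs
  · rw [neg_mul_neg, H.qq]
  · simp

lemma KData.zerase (H : KData q x y D V) {i : Fin N} {S} (h : i ∈ S) :
    zz q x y i S = zz q x y i (S.erase i) := by
  unfold zz
  rw [← mul_prod_erase S _ h, ← mul_prod_erase S _ h, H.fii, H.gii, one_mul, one_mul]

lemma KData.zzcomm (H : KData q x y D V) {i j : Fin N} (h : i ≠ j) (T : Finset (Fin N))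
    (hi : i ∉ T) (hj : j ∉ T) :
    zz q x y j (insert i T) * zz q x y i T + zz q x y i (insert j T) * zz q x y j T = 0 := by
  unfold zz
  rw [prod_insert hi, prod_insert hi, prod_insert hj, prod_insert hj]
  generalize (∏ s ∈ T, cf q s i) = ai
  generalize (∏ s ∈ T, cf q s j) = aj
  generalize (∏ s ∈ T, cg q s i) = bi
  generalize (∏ s ∈ T, cg q s j) = bj
  have e1 : cf q i j • (x j * x i) + cf q j i • (x i * x j) = 0 := by
    rw [H.xx i j, smul_smul, ← add_smul]
    have : cf q i j + cf q j i * q i j = 0 := by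
      unfold cf
      rcases lt_or_gt_of_ne h with h | h
      · simp [h, h.not_gt]
      · simp [h, h.not_gt, H.qq]
    rw [this, zero_smul]
  have e2 : cg q i j • (y j * y i) + cg q j i • (y i * y j) = 0 := by
    rw [H.yy i j, smul_smul, ← add_smul]
    have : cg q i j + cg q j i * q j i = 0 := by
      unfold cg
      rcases lt_or_gt_of_ne h with h | h
      · simp [h, h.not_gt, H.qq]
      · simp [h, h.not_gt]
    rw [this, zero_smul]
  have e3 := H.fg h
  have e4 := H.fg h.symm
  have : ((cf q i j * aj) • x j - (cg q i j * bj) • y j) * (ai • x i - bi • y i) +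
      ((cf q j i * ai) • x i - (cg q j i * bi) • y i) * (aj • x j - bj • y j) =
      (ai * aj) • (cf q i j • (x j * x i) + cf q j i • (x i * x j)) +
      (bi * bj) • (cg q i j • (y j * y i) + cg q j i • (y i * y j)) := by
    simp only [sub_mul, mul_sub, smul_mul_smul_comm, H.xy, e3, e4]
    module
  rw [this, e1, e2]; simp

lemma KData.iot_iot (H : KData q x y D V) (i j : Fin N) (c : Finset (Fin N) →₀ B) :
    iot q x y i (iot q x y j c) + iot q x y j (iot q x y i c) = 0 := by
  suffices h : iot q x y i ∘ₗ iot q x y j + iot q x y j ∘ₗ iot q x y i = 0 from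
    LinearMap.congr_fun h c
  refine Finsupp.lhom_ext fun S u => ?_
  simp only [LinearMap.add_apply, LinearMap.comp_apply, LinearMap.zero_apply]
  by_cases hij : i = j
  · subst hij
    by_cases hi : i ∈ S
    · rw [iot_mem _ _ _ hi, iot_not_mem]; · simp
      simp
    · rw [iot_not_mem _ _ _ hi]; simp
  by_cases hi : i ∈ S
  · by_cases hj : j ∈ S
    · have hji : j ∈ S.erase i := mem_erase.2 ⟨Ne.symm hij, hj⟩
      have hij' : i ∈ S.erase j := mem_erase.2 ⟨hij, hi⟩
      rw [iot_mem _ _ _ hi, iot_mem _ _ _ hj, iot_mem _ _ _ hji, iot_mem _ _ _ hij',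
        erase_right_comm, ← Finsupp.single_add, H.zerase hi, H.zerase hj, H.zerase hji,
        H.zerase hij', erase_right_comm (a := j)]
      have h1 : S.erase j = insert i ((S.erase i).erase j) := by
        rw [erase_right_comm, insert_erase hij']
      have h2 : S.erase i = insert j ((S.erase i).erase j) := by
        rw [insert_erase hji]
      have := H.zzcomm hij ((S.erase i).erase j) (by simp) (by simp)
      rw [← h1, ← h2] at this
      rw [mul_assoc, mul_assoc, ← mul_add, this, mul_zero, Finsupp.single_zero]
    · rw [iot_not_mem _ _ _ hj, iot_mem _ _ _ hi, iot_not_mem]; · simp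
      simp [hj]
  · by_cases hj : j ∈ S
    · rw [iot_not_mem _ _ _ hi, iot_mem _ _ _ hj, iot_not_mem]; · simp
      simp [hi]
    · rw [iot_not_mem _ _ _ hi, iot_not_mem _ _ _ hj]; simp

/-- Cross terms of the homotopy vanish. -/
lemma KData.iot_eps (H : KData q x y D V) {i l : Fin N} (hil : i ≠ l) (c : Finset (Fin N) →₀ B) :
    iot q x y i (eps q D l c) + eps q D l (iot q x y i c) = 0 := by
  suffices h : iot q x y i ∘ₗ eps q D l + eps q D l ∘ₗ iot q x y i = 0 from
    LinearMap.congr_fun h c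
  refine Finsupp.lhom_ext fun S u => ?_
  simp only [LinearMap.add_apply, LinearMap.comp_apply, LinearMap.zero_apply]
  by_cases hl : l ∈ S
  · rw [eps_mem _ _ hl]
    by_cases hi : i ∈ S
    · rw [iot_mem _ _ _ hi, eps_mem]; · simp
      simp [hl, Ne.symm hil]
    · rw [iot_not_mem _ _ _ hi]; simp
  by_cases hi : i ∈ S
  swap
  · rw [iot_not_mem _ _ _ hi, eps_not_mem _ _ hl, iot_not_mem]; · simp
    simp [hi, hil]
  obtain ⟨T, hiT, rfl⟩ : ∃ T, i ∉ T ∧ S = insert i T :=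
    ⟨S.erase i, by simp, by rw [insert_erase hi]⟩
  have hlT : l ∉ T := fun h => hl (by simp [h])
  have hi' : i ∈ insert l (insert i T) := by simp
  have hl' : l ∉ (insert i T).erase i := by simp [hlT]
  rw [iot_mem _ _ _ hi, eps_not_mem _ _ hl, iot_mem _ _ _ hi', eps_not_mem _ _ hl',
    H.zerase hi, H.zerase hi']
  have h1 : (insert l (insert i T)).erase i = insert l T := by
    rw [Finset.insert_comm, erase_insert]; simp [hiT, hil]
  rw [h1, erase_insert hiT, ← Finsupp.single_add]
  rw [Finsupp.single_eq_zero]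
  unfold zz
  rw [prod_insert hlT, prod_insert hlT, prod_insert hiT]
  generalize (∏ s ∈ T, cf q s i) = ai
  generalize (∏ s ∈ T, cg q s i) = bi
  generalize (∏ s ∈ T, cc q s l) = cl
  have e1 : q l i = - (cc q i l * cf q l i) := by
    unfold cf cc
    rcases lt_or_gt_of_ne hil with h | h
    · simp [h, h.not_gt]
    · simp [h, h.not_gt]
  have e2 : cc q i l * cg q l i = -1 := by
    unfold cg cc
    rcases lt_or_gt_of_ne hil with h | h
    · simp [h, h.not_gt, H.qq]
    · simp [h, h.not_gt]
  have e5 : D l (u * (ai • x i - bi • y i)) = ai • (q l i • (D l u * x i)) - bi • (D l u * y i) := by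
    rw [mul_sub, map_sub, mul_smul_comm, mul_smul_comm, map_smul, map_smul, H.Dx _ _ hil, H.Dy]
  rw [e5, e1]
  simp only [mul_sub, smul_mul_smul_comm]
  have : (cc q i l * cl * (cg q l i * bi)) = - (cl * bi) := by
    linear_combination cl * bi * e2
  rw [this]
  module

lemma KData.iot_eps_self (H : KData q x y D V) (i : Fin N) (S : Finset (Fin N)) :
    ∃ t : k, ∀ u, iot q x y i (eps q D i (Finsupp.single S u)) +
      eps q D i (iot q x y i (Finsupp.single S u)) =
      Finsupp.single S (D i u * x i + (if i ∈ S then u else 0) + t • (D i u * y i)) := by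
  have key : ∀ T : Finset (Fin N), (∏ s ∈ T, cc q s i) * (∏ s ∈ T, cf q s i) = 1 := by
    intro T; rw [← prod_mul_distrib]; exact prod_eq_one fun s _ => H.cfm s i
  by_cases hi : i ∈ S
  · refine ⟨-((∏ s ∈ S.erase i, cc q s i) * (∏ s ∈ S.erase i, cg q s i)), fun u => ?_⟩
    rw [eps_mem _ _ hi, iot_mem _ _ _ hi, eps_not_mem _ _ (by simp), insert_erase hi,
      H.zerase hi, if_pos hi, map_zero, zero_add]
    congr 1
    unfold zz
    rw [mul_sub, map_sub, mul_smul_comm, mul_smul_comm, map_smul, map_smul, H.Dxx, H.Dy, smul_sub,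
      smul_smul, smul_smul, key]
    module
  · refine ⟨-((∏ s ∈ S, cc q s i) * (∏ s ∈ S, cg q s i)), fun u => ?_⟩
    rw [iot_not_mem _ _ _ hi, eps_not_mem _ _ hi, iot_mem _ _ _ (by simp), erase_insert hi,
      H.zerase (by simp), erase_insert hi, if_neg hi, map_zero, add_zero]
    congr 1
    unfold zz
    rw [mul_sub, smul_mul_smul_comm, smul_mul_smul_comm, key]
    module

def td (q : Fin N → Fin N → k) (x y : Fin N → B) :
    (Finset (Fin N) →₀ B) →ₗ[k] (Finset (Fin N) →₀ B) := ∑ i, iot q x y i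
def th (q : Fin N → Fin N → k) (D : Fin N → B →ₗ[k] B) :
    (Finset (Fin N) →₀ B) →ₗ[k] (Finset (Fin N) →₀ B) := ∑ i, eps q D i

lemma KData.td_td [CharZero k] (H : KData q x y D V) (c) : td q x y (td q x y c) = 0 := by
  have : td q x y (td q x y c) + td q x y (td q x y c) = 0 := by
    simp only [td, LinearMap.sum_apply, map_sum]
    conv_lhs => arg 2; rw [sum_comm]
    rw [← sum_add_distrib]
    refine sum_eq_zero fun i _ => ?_
    rw [← sum_add_distrib]
    exact sum_eq_zero fun j _ => H.iot_iot _ _ _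
  have h2 : (2 : k) • td q x y (td q x y c) = 0 := by rw [two_smul]; exact this
  exact (smul_eq_zero.1 h2).resolve_left two_ne_zero

lemma KData.homotopy (H : KData q x y D V) (S : Finset (Fin N)) :
    ∃ t : Fin N → k, ∀ u, td q x y (th q D (Finsupp.single S u)) +
      th q D (td q x y (Finsupp.single S u)) =
      Finsupp.single S (∑ i, D i u * x i + (#S : k) • u + ∑ i, t i • (D i u * y i)) := by
  choose t ht using fun i => H.iot_eps_self i S
  refine ⟨t, fun u => ?_⟩
  simp only [td, th, LinearMap.sum_apply, map_sum]
  conv_lhs => arg 2; rw [sum_comm]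
  rw [← sum_add_distrib]
  have : ∀ i ∈ (univ : Finset (Fin N)), (∑ l, iot q x y l (eps q D i (Finsupp.single S u)) +
      ∑ l, eps q D i (iot q x y l (Finsupp.single S u))) =
      Finsupp.single S (D i u * x i + (if i ∈ S then u else 0) + t i • (D i u * y i)) := by
    intro i _
    rw [← sum_add_distrib, sum_eq_single i, ht]
    · intro l _ hl
      exact H.iot_eps hl _
    · simp
  have h3 : ∑ i, (if i ∈ S then u else 0) = (#S : k) • u := by
    rw [sum_ite_mem, univ_inter, sum_const, Nat.cast_smul_eq_nsmul]
  rw [← h3, ← sum_add_distrib, ← sum_add_distrib]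
  exact (sum_congr rfl this).trans (map_sum (Finsupp.singleAddHom S) _ _).symm

def GG (V : ℕ → Submodule k B) (N m n : ℕ) : Submodule k (Finset (Fin N) →₀ B) :=
  Submodule.span k {c | ∃ S : Finset (Fin N), #S = m ∧ ∃ u ∈ V n, c = Finsupp.single S u}

lemma KData.GG_step (H : KData q x y D V) (m n : ℕ) (c) (hc : c ∈ GG V N m (n+1)) :
    ((n + m : ℕ) : k) • c - (td q x y (th q D c) + th q D (td q x y c)) ∈ GG V N m n := by
  induction hc using Submodule.span_induction with
  | mem c hc =>
    obtain ⟨S, hS, u, hu, rfl⟩ := hc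
    obtain ⟨t, ht⟩ := H.homotopy S
    rw [ht, Finsupp.smul_single, ← Finsupp.single_sub]
    refine Submodule.subset_span ⟨S, hS, _, ?_, rfl⟩
    have := Submodule.sub_mem _ (H.VE n u hu) (Submodule.sum_mem _ (t := univ)
      fun i _ => Submodule.smul_mem _ (t i) (H.Vy n u hu i))
    convert this using 1
    rw [hS]; push_cast
    module
  | zero => simp
  | add a b _ _ ha hb =>
    convert add_mem ha hb using 1
    simp only [map_add, smul_add]; abel
  | smul r a _ ha =>
    convert Submodule.smul_mem _ r ha using 1
    simp only [map_smul, smul_sub, smul_add, smul_comm r]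

def MM (k : Type) [Field k] (B : Type) [Ring B] [Algebra k B] (N m : ℕ) :
    Submodule k (Finset (Fin N) →₀ B) := Finsupp.supported B k {S : Finset (Fin N) | #S = m}

lemma MM_induct {m : ℕ} {P : (Finset (Fin N) →₀ B) → Prop} (c) (hc : c ∈ MM k B N m)
    (h0 : P 0) (hadd : ∀ a b, P a → P b → P (a + b))
    (hs : ∀ S u, #S = m → P (Finsupp.single S u)) : P c := by
  rw [← Finsupp.sum_single c, Finsupp.sum]
  refine Finset.sum_induction _ P hadd h0 fun S hS => hs _ _ ?_
  exact (Finsupp.mem_supported _ _).1 hc hS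

lemma th_mem (q : Fin N → Fin N → k) (D : Fin N → B →ₗ[k] B) {m : ℕ} (c) (hc : c ∈ MM k B N m) :
    th q D c ∈ MM k B N (m+1) := by
  refine MM_induct (P := fun c => th q D c ∈ MM k B N (m+1)) c hc (by simp)
    (fun a b ha hb => by simpa using add_mem ha hb) fun S u hS => ?_
  simp only [th, LinearMap.sum_apply]
  refine Submodule.sum_mem _ fun i _ => ?_
  by_cases hi : i ∈ S
  · rw [eps_mem _ _ hi]; simp
  · rw [eps_not_mem _ _ hi]
    exact Finsupp.single_mem_supported _ _ (by simp [card_insert_of_notMem hi, hS])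

lemma KData.GG_le (_H : KData q x y D V) (m n : ℕ) : GG V N m n ≤ MM k B N m := by
  refine Submodule.span_le.2 ?_
  rintro _ ⟨S, hS, u, hu, rfl⟩
  exact Finsupp.single_mem_supported _ _ hS

lemma KData.exists_GG (H : KData q x y D V) (m : ℕ) (c) (hc : c ∈ MM k B N m) :
    ∃ n, c ∈ GG V N m n := by
  have mono : ∀ {n n'}, n ≤ n' → GG V N m n ≤ GG V N m n' := by
    intro n n' h
    refine Submodule.span_mono ?_
    rintro _ ⟨S, hS, u, hu, rfl⟩
    exact ⟨S, hS, u, H.Vmono h hu, rfl⟩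
  refine MM_induct (P := fun c => ∃ n, c ∈ GG V N m n) c hc ⟨0, by simp⟩ ?_ ?_
  · rintro a b ⟨n, ha⟩ ⟨n', hb⟩
    exact ⟨max n n', add_mem (mono (le_max_left _ _) ha) (mono (le_max_right _ _) hb)⟩
  · intro S u hS
    obtain ⟨n, hn⟩ := H.Vtop u
    exact ⟨n, Submodule.subset_span ⟨S, hS, u, hn, rfl⟩⟩

lemma KData.exact_aux [CharZero k] (H : KData q x y D V) (m n : ℕ) : ∀ c ∈ GG V N (m+1) n,
    td q x y c = 0 → ∃ e ∈ MM k B N (m+2), td q x y e = c := by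
  induction n with
  | zero =>
    intro c hc _
    have : GG V N (m+1) 0 ≤ ⊥ := by
      refine Submodule.span_le.2 ?_
      rintro _ ⟨S, hS, u, hu, rfl⟩
      rw [H.V0, Submodule.mem_bot] at hu
      simp [hu]
    have : c = 0 := by simpa using this hc
    exact ⟨0, by simp, by simp [this]⟩
  | succ n ih =>
    intro c hc hd
    have h1 := H.GG_step _ _ c hc
    rw [hd, map_zero, add_zero] at h1
    obtain ⟨e, he, hde⟩ := ih _ h1 (by simp [hd, H.td_td])
    have hne : ((n + (m+1) : ℕ) : k) ≠ 0 := Nat.cast_ne_zero.2 (by omega)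
    refine ⟨((n + (m+1) : ℕ) : k)⁻¹ • (e + th q D c),
      Submodule.smul_mem _ _ (add_mem he (th_mem q D c (H.GG_le _ _ hc))), ?_⟩
    rw [map_smul, map_add, hde, sub_add_cancel, inv_smul_smul₀ hne]

lemma KData.exact [CharZero k] (H : KData q x y D V) (m : ℕ) (c) (hc : c ∈ MM k B N (m+1))
    (hd : td q x y c = 0) : ∃ e ∈ MM k B N (m+2), td q x y e = c := by
  obtain ⟨n, hn⟩ := H.exists_GG _ _ hc
  exact H.exact_aux m n c hn hd

end AbstractKoszul

section Concrete
variable {k : Type} [Field k] {N : ℕ} {q : Fin N → Fin N → k}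

lemma X_rel (i j : Fin N) : X k N q i * X k N q j = q i j • (X k N q j * X k N q i) := by
  have := RingQuot.mkAlgHom_rel k (QRel.rel (q := q) i j)
  simpa [X] using this

lemma QSA_induct {P : QSA k N q → Prop} (halg : ∀ r, P (algebraMap k _ r))
    (hX : ∀ i, P (X k N q i)) (hmul : ∀ a b, P a → P b → P (a * b))
    (hadd : ∀ a b, P a → P b → P (a + b)) (a) : P a := by
  obtain ⟨a, rfl⟩ := RingQuot.mkAlgHom_surjective k (QRel k N q) a
  induction a using FreeAlgebra.induction with
  | grade0 r => rw [AlgHom.commutes]; exact halg r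
  | grade1 i => exact hX i
  | mul a b ha hb => rw [map_mul]; exact hmul _ _ ha hb
  | add a b ha hb => rw [map_add]; exact hadd _ _ ha hb

def phi0 (q : Fin N → Fin N → k) (i : Fin N) :
    FreeAlgebra k (Fin N) →ₐ[k] Matrix (Fin 2) (Fin 2) (QSA k N q) :=
  FreeAlgebra.lift k (fun j => !![X k N q j, if i = j then 1 else 0; 0, q i j • X k N q j])

lemma phi0_rel (hq0 : ∀ i j, q i j ≠ 0)
    (hqinv : ∀ i j, q j i = (q i j)⁻¹) (i : Fin N) ⦃a b : FreeAlgebra k (Fin N)⦄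
    (h : QRel k N q a b) : phi0 q i a = phi0 q i b := by
  have hqq : ∀ i j, q i j * q j i = 1 := fun i j => by
    rw [hqinv i j]; exact mul_inv_cancel₀ (hq0 i j)
  obtain ⟨l, m⟩ := h
  simp only [phi0, map_mul, map_smul, FreeAlgebra.lift_ι_apply]
  ext r s
  fin_cases r <;> fin_cases s
  · simp only [Matrix.mul_apply, Fin.sum_univ_two, Matrix.smul_apply]
    simp [X_rel l m]
  · simp only [Matrix.mul_apply, Fin.sum_univ_two, Matrix.smul_apply]
    simp
    by_cases hl : i = l
    · by_cases hm : i = m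
      · subst hl; subst hm
        simp only [if_true]
        have : q i i * q i i = 1 := hqq i i
        rw [smul_smul, this, one_smul, add_comm]
      · subst hl; simp [hm]
    · by_cases hm : i = m
      · subst hm; simp [hl, smul_smul, hqq]
      · simp [hl, hm]
  · simp [Matrix.mul_apply, Fin.sum_univ_two]
  · simp [Matrix.mul_apply, Fin.sum_univ_two, X_rel l m, smul_smul]
    congr 1; ring

def phi (hq0 : ∀ i j, q i j ≠ 0) (hqinv : ∀ i j, q j i = (q i j)⁻¹) (i : Fin N) :
    QSA k N q →ₐ[k] Matrix (Fin 2) (Fin 2) (QSA k N q) :=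
  RingQuot.liftAlgHom k ⟨phi0 q i, phi0_rel hq0 hqinv i⟩

variable (hq0 : ∀ i j, q i j ≠ 0) (hqinv : ∀ i j, q j i = (q i j)⁻¹)

lemma phi_X (i j : Fin N) : phi hq0 hqinv i (X k N q j) =
    !![X k N q j, if i = j then 1 else 0; 0, q i j • X k N q j] := by
  simp only [phi, X, RingQuot.liftAlgHom_mkAlgHom_apply, phi0, FreeAlgebra.lift_ι_apply]

lemma phi_00 (i : Fin N) (a) : phi hq0 hqinv i a 0 0 = a ∧ phi hq0 hqinv i a 1 0 = 0 := by
  induction a using QSA_induct with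
  | halg r => simp [AlgHom.commutes, Matrix.algebraMap_matrix_apply]
  | hX j => simp [phi_X]
  | hmul a b ha hb => simp [Matrix.mul_apply, Fin.sum_univ_two, ha, hb]
  | hadd a b ha hb => simp [ha, hb]

def DD (i : Fin N) : QSA k N q →ₗ[k] QSA k N q :=
  (Matrix.entryLinearMap k (QSA k N q) (0 : Fin 2) (1 : Fin 2)) ∘ₗ (phi hq0 hqinv i).toLinearMap

def sg (i : Fin N) (a : QSA k N q) : QSA k N q := phi hq0 hqinv i a 1 1

lemma DD_mul (i : Fin N) (a b) : DD hq0 hqinv i (a * b) =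
    a * DD hq0 hqinv i b + DD hq0 hqinv i a * sg hq0 hqinv i b := by
  simp [DD, sg, Matrix.mul_apply, Fin.sum_univ_two, phi_00]
lemma DD_X (i j : Fin N) : DD hq0 hqinv i (X k N q j) = if i = j then 1 else 0 := by
  simp [DD, phi_X]
lemma DD_one (i : Fin N) : DD hq0 hqinv i 1 = 0 := by
  simp [DD]
lemma sg_X (i j : Fin N) : sg hq0 hqinv i (X k N q j) = q i j • X k N q j := by
  simp [sg, phi_X]
lemma sg_one (i : Fin N) : sg hq0 hqinv i (1 : QSA k N q) = 1 := by
  simp [sg]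
lemma sg_mul (i : Fin N) (a b) : sg hq0 hqinv i (a * b) =
    sg hq0 hqinv i a * sg hq0 hqinv i b := by
  simp [sg, Matrix.mul_apply, Fin.sum_univ_two, phi_00]

def ww (q : Fin N → Fin N → k) (l : List (Fin N)) : QSA k N q := (l.map (X k N q)).prod
lemma ww_nil : ww q [] = 1 := rfl
lemma ww_cons (j : Fin N) (l) : ww q (j :: l) = X k N q j * ww q l := by simp [ww]
lemma ww_append (l l') : ww q (l ++ l') = ww q l * ww q l' := by simp [ww]

lemma ww_span (a : QSA k N q) : a ∈ Submodule.span k (Set.range (ww q)) := by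
  induction a using QSA_induct with
  | halg r =>
    rw [Algebra.algebraMap_eq_smul_one]
    exact Submodule.smul_mem _ _ (Submodule.subset_span ⟨[], rfl⟩)
  | hX i => exact Submodule.subset_span ⟨[i], by simp [ww]⟩
  | hadd a b ha hb => exact add_mem ha hb
  | hmul a b ha hb =>
    have := Submodule.mul_mem_mul ha hb
    rw [Submodule.span_mul_span] at this
    refine Submodule.span_mono ?_ this
    rintro _ ⟨_, ⟨l, rfl⟩, _, ⟨l', rfl⟩, rfl⟩
    exact ⟨l ++ l', ww_append _ _⟩

lemma sg_ww (i : Fin N) (l) : ∃ r : k, sg hq0 hqinv i (ww q l) = r • ww q l := by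
  induction l with
  | nil => exact ⟨1, by rw [ww_nil, sg_one, one_smul]⟩
  | cons j l ih =>
    obtain ⟨r, hr⟩ := ih
    exact ⟨q i j * r, by rw [ww_cons, sg_mul, hr, sg_X, smul_mul_smul_comm]⟩

lemma sg_ww_X (i : Fin N) (l) : sg hq0 hqinv i (ww q l) * X k N q i = X k N q i * ww q l := by
  induction l with
  | nil => rw [ww_nil, sg_one, one_mul, mul_one]
  | cons j l ih =>
    rw [ww_cons, sg_mul, mul_assoc, ih, sg_X, ← mul_assoc, smul_mul_assoc, ← X_rel, mul_assoc]

lemma euler (l) : ∑ i, DD hq0 hqinv i (ww q l) * X k N q i = (l.length : k) • ww q l := by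
  induction l with
  | nil => simp [ww_nil, DD_one]
  | cons j l ih =>
    simp only [ww_cons, DD_mul, add_mul, Finset.sum_add_distrib, DD_X]
    simp only [mul_assoc, ← Finset.mul_sum, ih]
    rw [Finset.sum_eq_single j]
    · rw [if_pos rfl, one_mul, sg_ww_X]
      rw [List.length_cons, mul_smul_comm]; push_cast; module
    · intro i _ hi; simp [hi]
    · simp

def VA (q : Fin N → Fin N → k) (n : ℕ) : Submodule k (QSA k N q) :=
  Submodule.span k {a | ∃ l : List (Fin N), l.length < n ∧ a = ww q l}

lemma DD_ww (i : Fin N) (l) : DD hq0 hqinv i (ww q l) ∈ VA q l.length := by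
  induction l with
  | nil => rw [ww_nil, DD_one]; exact zero_mem _
  | cons j l ih =>
    rw [ww_cons, DD_mul, DD_X]
    refine add_mem ?_ ?_
    · have : VA q l.length ≤ (VA q (j :: l).length).comap (LinearMap.mulLeft k (X k N q j)) := by
        refine Submodule.span_le.2 ?_
        rintro _ ⟨l', hl', rfl⟩
        exact Submodule.subset_span ⟨j :: l', by simpa using hl', by simp [ww_cons]⟩
      exact this ih
    · split_ifs
      · obtain ⟨r, hr⟩ := sg_ww hq0 hqinv i l
        rw [one_mul, hr]
        exact Submodule.smul_mem _ _ (Submodule.subset_span ⟨l, by simp, rfl⟩)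
      · rw [zero_mul]; exact zero_mem _

def VB (q : Fin N → Fin N → k) (n : ℕ) : Submodule k (QSAe k N q) :=
  Submodule.span k {a | ∃ l : List (Fin N), l.length < n ∧ ∃ b, a = ww q l ⊗ₜ[k] b}

lemma VA_VB {n : ℕ} {a : QSA k N q} (ha : a ∈ VA q n) (b : (QSA k N q)ᵐᵒᵖ) :
    a ⊗ₜ[k] b ∈ VB q n := by
  have : VA q n ≤ (VB q n).comap ((TensorProduct.mk k _ _).flip b) := by
    refine Submodule.span_le.2 ?_
    rintro _ ⟨l', hl', rfl⟩
    exact Submodule.subset_span ⟨l', hl', b, rfl⟩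
  exact this ha

lemma VA_mono : Monotone (VA q) := by
  intro n n' h
  refine Submodule.span_mono ?_
  rintro _ ⟨l, hl, rfl⟩
  exact ⟨l, hl.trans_le h, rfl⟩
lemma VB_mono : Monotone (VB q) := by
  intro n n' h
  refine Submodule.span_mono ?_
  rintro _ ⟨l, hl, b, rfl⟩
  exact ⟨l, hl.trans_le h, b, rfl⟩

lemma VA_top (a : QSA k N q) : ∃ n, a ∈ VA q n := by
  induction ww_span a using Submodule.span_induction with
  | mem a ha =>
    obtain ⟨l, rfl⟩ := ha
    exact ⟨l.length + 1, Submodule.subset_span ⟨l, by simp, rfl⟩⟩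
  | zero => exact ⟨0, zero_mem _⟩
  | add a b _ _ ha hb =>
    obtain ⟨n, ha⟩ := ha
    obtain ⟨n', hb⟩ := hb
    exact ⟨max n n', add_mem (VA_mono (le_max_left _ _) ha) (VA_mono (le_max_right _ _) hb)⟩
  | smul r a _ ha =>
    obtain ⟨n, ha⟩ := ha
    exact ⟨n, Submodule.smul_mem _ r ha⟩

lemma VB_top (u : QSAe k N q) : ∃ n, u ∈ VB q n := by
  induction u using TensorProduct.induction_on with
  | zero => exact ⟨0, zero_mem _⟩
  | tmul a b =>
    obtain ⟨n, ha⟩ := VA_top a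
    exact ⟨n, VA_VB ha b⟩
  | add a b ha hb =>
    obtain ⟨n, ha⟩ := ha
    obtain ⟨n', hb⟩ := hb
    exact ⟨max n n', add_mem (VB_mono (le_max_left _ _) ha) (VB_mono (le_max_right _ _) hb)⟩

def xB (q : Fin N → Fin N → k) (i : Fin N) : QSAe k N q := X k N q i ⊗ₜ[k] 1
def yB (q : Fin N → Fin N → k) (i : Fin N) : QSAe k N q :=
  (1 : QSA k N q) ⊗ₜ[k] MulOpposite.op (X k N q i)
def DB (i : Fin N) : QSAe k N q →ₗ[k] QSAe k N q := LinearMap.rTensor _ (DD hq0 hqinv i)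

lemma DB_tmul (i : Fin N) (a : QSA k N q) (b) :
    DB hq0 hqinv i (a ⊗ₜ[k] b) = DD hq0 hqinv i a ⊗ₜ[k] b := rfl

lemma tmul_xB (i : Fin N) (a : QSA k N q) (b : (QSA k N q)ᵐᵒᵖ) :
    (a ⊗ₜ[k] b) * xB q i = (a * X k N q i) ⊗ₜ[k] b := by
  rw [xB, Algebra.TensorProduct.tmul_mul_tmul, mul_one]
lemma tmul_yB (i : Fin N) (a : QSA k N q) (b : (QSA k N q)ᵐᵒᵖ) :
    (a ⊗ₜ[k] b) * yB q i = a ⊗ₜ[k] (b * MulOpposite.op (X k N q i)) := by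
  rw [yB, Algebra.TensorProduct.tmul_mul_tmul, mul_one]

lemma kdata (hq1 : ∀ i, q i i = 1) : KData q (xB q) (yB q) (DB hq0 hqinv) (VB q) where
  q0 := hq0
  q1 := hq1
  qinv := hqinv
  xx i j := by
    unfold xB
    rw [Algebra.TensorProduct.tmul_mul_tmul, Algebra.TensorProduct.tmul_mul_tmul, X_rel,
      TensorProduct.smul_tmul']
  yy i j := by
    unfold yB
    rw [Algebra.TensorProduct.tmul_mul_tmul, Algebra.TensorProduct.tmul_mul_tmul,
      ← MulOpposite.op_mul, ← MulOpposite.op_mul, X_rel, MulOpposite.op_smul,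
      TensorProduct.tmul_smul]
  xy i j := by
    unfold xB yB
    simp only [Algebra.TensorProduct.tmul_mul_tmul, one_mul, mul_one]
  Dx i l h u := by
    induction u using TensorProduct.induction_on with
    | zero => simp
    | add a b ha hb => simp only [add_mul, map_add, ha, hb, smul_add]
    | tmul a b =>
      rw [tmul_xB, DB_tmul, DB_tmul, tmul_xB, DD_mul, DD_X, if_neg (Ne.symm h), sg_X, mul_zero,
        zero_add, mul_smul_comm, TensorProduct.smul_tmul']
  Dxx i u := by
    induction u using TensorProduct.induction_on with
    | zero => simp
    | add a b ha hb => simp only [add_mul, map_add, ha, hb]; abel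
    | tmul a b =>
      rw [tmul_xB, DB_tmul, DB_tmul, tmul_xB, DD_mul, DD_X, if_pos rfl, sg_X, hq1, one_smul,
        mul_one, TensorProduct.add_tmul, add_comm]
  Dy i l u := by
    induction u using TensorProduct.induction_on with
    | zero => simp
    | add a b ha hb => simp only [add_mul, map_add, ha, hb]
    | tmul a b => rw [tmul_yB, DB_tmul, DB_tmul, tmul_yB]
  V0 := by
    rw [eq_bot_iff]
    refine Submodule.span_le.2 ?_
    rintro _ ⟨l, hl, _⟩
    exact absurd hl (by simp)
  Vtop := VB_top
  Vmono := VB_mono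
  VE n u hu := by
    induction hu using Submodule.span_induction with
    | mem u hu =>
      obtain ⟨l, hl, b, rfl⟩ := hu
      simp only [DB_tmul, tmul_xB]
      rw [← TensorProduct.sum_tmul, euler, TensorProduct.smul_tmul', ← TensorProduct.sub_tmul,
        ← sub_smul]
      refine VA_VB ?_ b
      rcases Nat.lt_succ_iff_lt_or_eq.1 hl with h | h
      · exact Submodule.smul_mem _ _ (Submodule.subset_span ⟨l, h, rfl⟩)
      · rw [h, sub_self, zero_smul]; exact zero_mem _
    | zero => simp
    | add a b _ _ ha hb =>
      convert add_mem ha hb using 1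
      simp only [map_add, add_mul, Finset.sum_add_distrib, smul_add]; abel
    | smul r a _ ha =>
      convert Submodule.smul_mem _ r ha using 1
      simp only [map_smul, smul_sub, smul_mul_assoc, Finset.smul_sum, smul_comm r]
  Vy n u hu i := by
    induction hu using Submodule.span_induction with
    | mem u hu =>
      obtain ⟨l, hl, b, rfl⟩ := hu
      rw [DB_tmul, tmul_yB]
      exact VA_VB (VA_mono (Nat.lt_succ_iff.1 hl) (DD_ww hq0 hqinv i l)) _
    | zero => simp
    | add a b _ _ ha hb =>
      convert add_mem ha hb using 1
      simp only [map_add, add_mul]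
    | smul r a _ ha =>
      convert Submodule.smul_mem _ r ha using 1
      simp only [map_smul, smul_mul_assoc]

def JJ (q : Fin N → Fin N → k) (m : ℕ) (c : KM k N q m) : Finset (Fin N) →₀ QSAe k N q :=
  Finsupp.mapDomain Subtype.val c

lemma JJ_inj (m : ℕ) : Function.Injective (JJ q m) :=
  Finsupp.mapDomain_injective Subtype.val_injective
lemma JJ_add (m : ℕ) (a b) : JJ q m (a + b) = JJ q m a + JJ q m b := Finsupp.mapDomain_add
lemma JJ_zero (m : ℕ) : JJ q m 0 = 0 := Finsupp.mapDomain_zero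
lemma JJ_sum (m : ℕ) {ι : Type} (s : Finset ι) (f : ι → KM k N q m) :
    JJ q m (∑ i ∈ s, f i) = ∑ i ∈ s, JJ q m (f i) := Finsupp.mapDomain_finsetSum
lemma JJ_single (m : ℕ) (S u) : JJ q m (Finsupp.single S u) = Finsupp.single S.1 u :=
  Finsupp.mapDomain_single

lemma JJ_surj (m : ℕ) (e) (he : e ∈ MM k (QSAe k N q) N m) : ∃ c, JJ q m c = e := by
  refine MM_induct (P := fun e => ∃ c, JJ q m c = e) e he ⟨0, JJ_zero m⟩ ?_ ?_
  · rintro _ _ ⟨a, rfl⟩ ⟨b, rfl⟩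
    exact ⟨a + b, JJ_add _ _ _⟩
  · intro S u hS
    exact ⟨Finsupp.single ⟨S, hS⟩ u, JJ_single _ _ _⟩

lemma JJ_mem (m : ℕ) (c) : JJ q m c ∈ MM k (QSAe k N q) N m := by
  induction c using Finsupp.induction_linear with
  | zero => rw [JJ_zero]; exact zero_mem _
  | add a b ha hb => rw [JJ_add]; exact add_mem ha hb
  | single S u => rw [JJ_single]; exact Finsupp.single_mem_supported _ _ S.2

lemma coef_x (hq1 : ∀ i, q i i = 1) (S : Finset (Fin N)) (i : Fin N) :
    (-1 : k) ^ (S.filter (fun s => s < i)).card * ∏ s ∈ S.filter (fun s => s ≤ i), q s i =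
    ∏ s ∈ S, cf q s i := by
  rw [← Finset.prod_const, Finset.prod_filter, Finset.prod_filter, ← Finset.prod_mul_distrib]
  refine Finset.prod_congr rfl fun s _ => ?_
  unfold cf
  rcases lt_trichotomy s i with h | h | h
  · simp [h, h.le]
  · simp [h, hq1]
  · simp [h.not_gt, h.not_ge]

lemma coef_y (hq1 : ∀ i, q i i = 1) (S : Finset (Fin N)) (i : Fin N) :
    (-1 : k) ^ (S.filter (fun s => s < i)).card * ∏ s ∈ S.filter (fun s => i ≤ s), q i s =
    ∏ s ∈ S, cg q s i := by
  rw [← Finset.prod_const, Finset.prod_filter, Finset.prod_filter, ← Finset.prod_mul_distrib]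
  refine Finset.prod_congr rfl fun s _ => ?_
  unfold cg
  rcases lt_trichotomy s i with h | h | h
  · simp [h, h.not_ge]
  · simp [h, hq1]
  · simp [h.not_gt, h.le]

lemma JJ_kd (hq1 : ∀ i, q i i = 1) (m : ℕ) (c) :
    JJ q m (kd k N q m c) = td q (xB q) (yB q) (JJ q (m+1) c) := by
  induction c using Finsupp.induction_linear with
  | zero => rw [map_zero, JJ_zero, JJ_zero, map_zero]
  | add a b ha hb => rw [map_add, JJ_add, JJ_add, map_add, ha, hb]
  | single S u =>
    rw [JJ_single, kd, Finsupp.linearCombination_single, Finset.smul_sum, JJ_sum, td,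
      LinearMap.sum_apply]
    have h1 : ∑ i, iot q (xB q) (yB q) i (Finsupp.single S.1 u) =
        ∑ i ∈ S.1, iot q (xB q) (yB q) i (Finsupp.single S.1 u) := by
      refine (Finset.sum_subset (Finset.subset_univ _) fun i _ hi => ?_).symm
      exact iot_not_mem _ _ _ hi _
    rw [h1, ← Finset.sum_attach S.1]
    refine Finset.sum_congr rfl fun i _ => ?_
    rw [iot_mem _ _ _ i.2, Finsupp.smul_single, Finsupp.smul_single, JJ_single, smul_sub,
      smul_smul, smul_smul, coef_x hq1, coef_y hq1]
    rfl

lemma aug_smul (a b c : QSA k N q) : (a ⊗ₜ[k] MulOpposite.op b : QSAe k N q) • c = a * (c * b) :=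
  rfl

lemma kaug_single (S) (u) : kaug k N q (Finsupp.single S u) = u • (1 : QSA k N q) := by
  rw [kaug, Finsupp.linearCombination_single]

end Concrete

section ExactZero
variable {k : Type} [Field k] {N : ℕ} {q : Fin N → Fin N → k}

lemma e_mul_sub (a b c : QSAe k N q) : a * (b - c) = a * b - a * c := mul_sub a b c
lemma e_sub_zero (a : QSAe k N q) : a - 0 = a := sub_zero a
lemma e_zero_smul (a : QSA k N q) : (0 : QSAe k N q) • a = 0 :=
  Module.zero_smul (R := QSAe k N q) a

/-- The left ideal generated by the `x_i ⊗ 1 - 1 ⊗ x_i`. -/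
def II (q : Fin N → Fin N → k) : Submodule (QSAe k N q) (QSAe k N q) :=
  Submodule.span (QSAe k N q) (Set.range fun i => xB q i - yB q i)

lemma II_diff (a : QSA k N q) :
    (a ⊗ₜ[k] (1 : (QSA k N q)ᵐᵒᵖ) - (1 : QSA k N q) ⊗ₜ[k] MulOpposite.op a : QSAe k N q)
      ∈ II q := by
  induction a using QSA_induct with
  | halg r =>
    convert zero_mem (II q)
    rw [Algebra.algebraMap_eq_smul_one, MulOpposite.op_smul, TensorProduct.tmul_smul,
      ← TensorProduct.smul_tmul', MulOpposite.op_one, sub_self]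
  | hX i => exact Submodule.subset_span ⟨i, rfl⟩
  | hadd a b ha hb =>
    convert add_mem ha hb using 1
    rw [MulOpposite.op_add, TensorProduct.tmul_add, TensorProduct.add_tmul]; abel
  | hmul a b ha hb =>
    convert add_mem (Submodule.smul_mem _ (a ⊗ₜ[k] (1 : (QSA k N q)ᵐᵒᵖ) : QSAe k N q) hb)
      (Submodule.smul_mem _ ((1 : QSA k N q) ⊗ₜ[k] MulOpposite.op b : QSAe k N q) ha) using 1
    simp only [smul_eq_mul, e_mul_sub, Algebra.TensorProduct.tmul_mul_tmul, one_mul, mul_one,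
      MulOpposite.op_mul]
    abel

lemma II_all (u : QSAe k N q) :
    u - (1 : QSA k N q) ⊗ₜ[k] MulOpposite.op (u • (1 : QSA k N q)) ∈ II q := by
  induction u using TensorProduct.induction_on with
  | zero =>
    rw [e_zero_smul, MulOpposite.op_zero, TensorProduct.tmul_zero, e_sub_zero]; exact zero_mem _
  | add a b ha hb =>
    convert add_mem ha hb using 1
    rw [add_smul, MulOpposite.op_add, TensorProduct.tmul_add]; abel
  | tmul a b =>
    induction b using MulOpposite.rec' with
    | _ b =>
    convert Submodule.smul_mem _ ((1 : QSA k N q) ⊗ₜ[k] MulOpposite.op b : QSAe k N q)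
      (II_diff a) using 1
    rw [aug_smul, one_mul]
    simp only [smul_eq_mul, e_mul_sub, Algebra.TensorProduct.tmul_mul_tmul, one_mul, mul_one,
      MulOpposite.op_mul]

lemma kd_zero_single (hq1 : ∀ i, q i i = 1) (i : Fin N) (u : QSAe k N q) :
    kd k N q 0 (Finsupp.single ⟨{i}, rfl⟩ u) =
      Finsupp.single ⟨∅, rfl⟩ (u * (xB q i - yB q i)) := by
  apply JJ_inj
  rw [JJ_kd hq1, JJ_single, JJ_single, td, LinearMap.sum_apply, Finset.sum_eq_single i]
  · rw [iot_mem _ _ _ (by simp)]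
    simp [zz, cf, cg, hq1]
  · intro j _ hj
    exact iot_not_mem _ _ _ (by simpa using hj) _
  · simp

lemma exact_zero (hq1 : ∀ i, q i i = 1) :
    LinearMap.range (kd k N q 0) = LinearMap.ker (kaug k N q) := by
  apply le_antisymm
  · rintro _ ⟨c, rfl⟩
    rw [LinearMap.mem_ker]
    induction c using Finsupp.induction_linear with
    | zero => rw [map_zero, map_zero]
    | add a b ha hb => rw [map_add, map_add, ha, hb, add_zero]
    | single S u =>
      obtain ⟨S, hS⟩ := S
      obtain ⟨i, rfl⟩ := Finset.card_eq_one.1 hS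
      rw [kd_zero_single hq1, kaug_single, mul_smul, sub_smul, xB, yB,
        ← MulOpposite.op_one, aug_smul, aug_smul, mul_one, mul_one, one_mul, one_mul, sub_self,
        smul_zero]
  · intro c hc
    have hc' : c = Finsupp.single ⟨∅, rfl⟩ (c ⟨∅, rfl⟩) := by
      ext ⟨S, hS⟩
      obtain rfl := Finset.card_eq_zero.1 hS
      rw [Finsupp.single_eq_same]
    rw [hc'] at hc ⊢
    generalize c ⟨∅, rfl⟩ = u at hc ⊢
    rw [LinearMap.mem_ker, kaug_single] at hc
    have h := II_all u
    rw [hc, MulOpposite.op_zero, TensorProduct.tmul_zero, e_sub_zero] at h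
    have : II q ≤ (LinearMap.range (kd k N q 0)).comap
        (Finsupp.lsingle (⟨∅, rfl⟩ : {S : Finset (Fin N) // S.card = 0})) := by
      refine Submodule.span_le.2 ?_
      rintro _ ⟨i, rfl⟩
      refine ⟨Finsupp.single ⟨{i}, rfl⟩ 1, ?_⟩
      rw [kd_zero_single hq1, one_mul]
      rfl
    exact this h

end ExactZero

/-- The Koszul complex `0 → A^e ⊗ ∧^N(V) → ⋯ → A^e ⊗ ∧^1(V) → A^e → A → 0` is exact,
i.e. it is a free resolution of `A = S_q(V)` as a left `A^e`-module.  (All the modules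
`KM m` are free `A^e`-modules by construction, the maps are `A^e`-linear, and `KM m = 0`
for `m > N`, so the three conditions below express exactness of the full complex,
including injectivity of `d_N` and surjectivity of the multiplication map.) -/
theorem stmt3 (k : Type) [Field k] [CharZero k] (N : ℕ) (hN : 0 < N)
    (q : Fin N → Fin N → k) (hq0 : ∀ i j, q i j ≠ 0) (hq1 : ∀ i, q i i = 1)
    (hqinv : ∀ i j, q j i = (q i j)⁻¹) :
    Function.Surjective (kaug k N q) ∧
    LinearMap.range (kd k N q 0) = LinearMap.ker (kaug k N q) ∧
    (∀ m : ℕ, LinearMap.range (kd k N q (m + 1)) = LinearMap.ker (kd k N q m)) := by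
  have H := kdata hq0 hqinv hq1
  refine ⟨?_, ?_, ?_⟩
  · intro a
    refine ⟨Finsupp.single ⟨∅, rfl⟩ (a ⊗ₜ[k] MulOpposite.op 1), ?_⟩
    rw [kaug_single, aug_smul, one_mul, mul_one]
  · exact exact_zero hq1
  · intro m
    ext c
    rw [LinearMap.mem_ker, LinearMap.mem_range]
    constructor
    · rintro ⟨e, rfl⟩
      apply JJ_inj
      rw [JJ_kd hq1, JJ_kd hq1, H.td_td, JJ_zero]
    · intro hc
      have h1 := JJ_kd hq1 m c
      rw [hc, JJ_zero] at h1
      obtain ⟨e, he, hde⟩ := H.exact m _ (JJ_mem _ c) h1.symm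
      obtain ⟨e, rfl⟩ := JJ_surj _ e he
      refine ⟨e, JJ_inj _ ?_⟩
      rw [JJ_kd hq1, hde]
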